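/- arXiv:1909.11530 — 2 statements merged into one kernel-verified Lean document; each statement's English description precedes it below -/
import Mathlib

section
/- For j ∈ ℕ and 0 ≤ k ≤ 2^j − 1 let I_k^j := {(t cos(kπ/2^j), t sin(kπ/2^j)) ∈ ℝ² : t ∈ [−1,1]}, let A_j := ⋃_{k=0}^{2^j−1} I_k^j, and let X := ⋃_{j=1}^∞ 2^{−2j−1}A_j ⊂ ℝ², where aA := {(ax,ay) : (x,y) ∈ A}. Equip X with the metric inherited from ℝ² and the measure ℋ¹ restricted to X. Then ℋ¹ is doubling on X: there exists C (one may take C = 2^18) such that ℋ¹(B(x,2r) ∩ X) ≤ C·ℋ¹(B(x,r) ∩ X) for all x ∈ X and r > 0, where B(x,r) are Euclidean balls. -/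
open MeasureTheory Set Filter Topology ENNReal

noncomputable abbrev E2 := EuclideanSpace ℝ (Fin 2)

/-- The segment `I_k^j` through the origin at angle `kπ/2^j`, of length 2. -/
noncomputable def segIkj (j k : ℕ) : Set E2 :=
  (fun t : ℝ => (!₂[t * Real.cos (k * Real.pi / 2 ^ j),
                   t * Real.sin (k * Real.pi / 2 ^ j)] : E2)) '' Set.Icc (-1 : ℝ) 1

/-- `A_j = ⋃_{k=0}^{2^j-1} I_k^j`. -/
noncomputable def setAj (j : ℕ) : Set E2 := ⋃ k < 2 ^ j, segIkj j k

/-- Scaling of a planar set by a factor `a`. -/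
noncomputable def scaleSet (a : ℝ) (A : Set E2) : Set E2 := (fun p : E2 => a • p) '' A

/-- The space `X = ⋃_{j≥1} 2^{-2j-1} A_j ⊂ ℝ²`. -/
noncomputable def spaceX : Set E2 :=
  ⋃ (j : ℕ) (_ : 1 ≤ j), scaleSet ((2 : ℝ) ^ (-(2 * (j : ℤ)) - 1)) (setAj j)

/-- Polar point. -/
noncomputable def pp (t θ : ℝ) : E2 := !₂[t * Real.cos θ, t * Real.sin θ]

/-- The radius at level `j`. -/
noncomputable def aj (j : ℕ) : ℝ := (1 / 4) ^ j / 2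

lemma aj_eq (j : ℕ) : (2 : ℝ) ^ (-(2 * (j : ℤ)) - 1) = aj j := by
  unfold aj
  rw [zpow_sub₀ (by norm_num), zpow_neg, zpow_mul]
  rw [one_div, inv_pow]
  norm_num

lemma aj_pos (j : ℕ) : 0 < aj j := by unfold aj; positivity

lemma aj_anti {i j : ℕ} (h : i ≤ j) : aj j ≤ aj i := by
  unfold aj
  have := pow_le_pow_of_le_one (by norm_num : (0:ℝ) ≤ 1/4) (by norm_num) h
  linarith

lemma pp_dist_sq (s t α β : ℝ) :
    dist (pp s α) (pp t β) ^ 2 = (s - t) ^ 2 + 2 * s * t * (1 - Real.cos (α - β)) := by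
  rw [EuclideanSpace.dist_eq, Real.sq_sqrt (by positivity)]
  simp only [Fin.sum_univ_two, Real.dist_eq, sq_abs, pp]
  simp
  rw [Real.cos_sub]
  have h1 := Real.sin_sq_add_cos_sq α
  have h2 := Real.sin_sq_add_cos_sq β
  linear_combination s ^ 2 * h1 + t ^ 2 * h2

lemma pp_isometry (θ : ℝ) : Isometry (fun t => pp t θ) := by
  refine Isometry.of_dist_eq fun s t => ?_
  have h := pp_dist_sq s t θ θ
  simp at h
  rw [Real.dist_eq, ← abs_of_nonneg (dist_nonneg (x := pp s θ) (y := pp t θ))]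
  exact (sq_eq_sq_iff_abs_eq_abs _ _).1 h

lemma pp_neg (t θ : ℝ) : pp (-t) θ = pp t (θ + Real.pi) := by
  unfold pp; ext i; fin_cases i <;> simp

lemma pp_int (t θ : ℝ) (q : ℤ) : ∃ t', |t'| = |t| ∧ pp t (θ + q * Real.pi) = pp t' θ := by
  refine ⟨(-1) ^ q * t, ?_, ?_⟩
  · rw [abs_mul, abs_zpow]; simp
  · unfold pp; rw [Real.cos_add_int_mul_pi, Real.sin_add_int_mul_pi]
    ext i; fin_cases i <;> simp <;> ring

lemma pp_norm_dist (t θ : ℝ) : dist (pp t θ) 0 = |t| := by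
  have h : (0 : E2) = pp 0 θ := by unfold pp; ext i; fin_cases i <;> simp
  rw [h, (pp_isometry θ).dist_eq, Real.dist_eq, sub_zero]

lemma pp_measure (θ : ℝ) (T : Set ℝ) : μH[1] ((fun t => pp t θ) '' T) = volume T := by
  rw [(pp_isometry θ).hausdorffMeasure_image (Or.inl zero_le_one), hausdorffMeasure_real]

/-- reduce the angle index modulo `2^j`. -/
lemma pp_reduce (t : ℝ) (j : ℕ) (k : ℤ) : ∃ t' : ℝ, ∃ m : ℕ, m < 2 ^ j ∧ |t'| = |t| ∧
    pp t (k * Real.pi / 2 ^ j) = pp t' (m * Real.pi / 2 ^ j) := by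
  have hpos : (0 : ℤ) < 2 ^ j := by positivity
  obtain ⟨m, hm⟩ := Int.eq_ofNat_of_zero_le (Int.emod_nonneg k hpos.ne')
  have hlt := Int.emod_lt_of_pos k hpos
  have hk := Int.emod_add_mul_ediv k (2 ^ j)
  rw [hm] at hk hlt
  obtain ⟨t', h1, h2⟩ := pp_int t (m * Real.pi / 2 ^ j) (k / 2 ^ j)
  refine ⟨t', m, by exact_mod_cast hlt, h1, ?_⟩
  rw [← h2]
  congr 1
  have hk' : (m : ℝ) + 2 ^ j * ((k / 2 ^ j : ℤ) : ℝ) = k := by exact_mod_cast hk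
  rw [← hk']
  field_simp

lemma mem_X_nat (y : E2) : y ∈ spaceX ↔ ∃ j : ℕ, 1 ≤ j ∧ ∃ k : ℕ, k < 2 ^ j ∧ ∃ t : ℝ, |t| ≤ aj j ∧
    y = pp t (k * Real.pi / 2 ^ j) := by
  simp only [spaceX, scaleSet, setAj, segIkj, mem_iUnion, mem_image, exists_prop]
  constructor
  · rintro ⟨j, hj, p, ⟨k, hk, t, ht, rfl⟩, rfl⟩
    refine ⟨j, hj, k, hk, aj j * t, ?_, ?_⟩
    · rw [abs_mul, abs_of_pos (aj_pos j)]
      have := abs_le.2 ht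
      nlinarith [aj_pos j]
    · rw [aj_eq]; unfold pp; ext i; fin_cases i <;> simp <;> ring
  · rintro ⟨j, hj, k, hk, t, ht, rfl⟩
    refine ⟨j, hj, _, ⟨k, hk, t / aj j, ?_, rfl⟩, ?_⟩
    · rw [mem_Icc, ← abs_le, abs_div, abs_of_pos (aj_pos j), div_le_one (aj_pos j)]
      exact ht
    · have := (aj_pos j).ne'
      rw [aj_eq]; unfold pp; ext i; fin_cases i <;> simp <;> field_simp

lemma mem_X (y : E2) : y ∈ spaceX ↔ ∃ j : ℕ, 1 ≤ j ∧ ∃ k : ℤ, ∃ t : ℝ, |t| ≤ aj j ∧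
    y = pp t (k * Real.pi / 2 ^ j) := by
  rw [mem_X_nat]
  constructor
  · rintro ⟨j, hj, k, hk, t, ht, h⟩
    exact ⟨j, hj, k, t, ht, by simpa using h⟩
  · rintro ⟨j, hj, k, t, ht, rfl⟩
    obtain ⟨t', m, hm, h1, h2⟩ := pp_reduce t j k
    exact ⟨j, hj, m, hm, t', h1 ▸ ht, h2⟩

lemma angle_lift {i j : ℕ} (h : i ≤ j) (k : ℤ) :
    ∃ k' : ℤ, (k : ℝ) * Real.pi / 2 ^ i = k' * Real.pi / 2 ^ j := by
  obtain ⟨d, rfl⟩ := Nat.exists_eq_add_of_le h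
  refine ⟨k * 2 ^ d, ?_⟩
  push_cast
  rw [pow_add]
  field_simp

/-- General lower bound: disjoint ray pieces. -/
lemma lower (j : ℕ) (hj : 1 ≤ j) (F : Finset ℤ) (hF : ∀ k ∈ F, ∀ l ∈ F, |k - l| < 2 * 2 ^ j)
    (c d : ℝ) (hc : 0 ≤ c) (hd : d ≤ aj j) (x : E2) (r : ℝ)
    (h : ∀ k ∈ F, ∀ s ∈ Ioo c d, pp s (k * Real.pi / 2 ^ j) ∈ Metric.ball x r) :
    (F.card : ℝ≥0∞) * ENNReal.ofReal (d - c) ≤ μH[1] (Metric.ball x r ∩ spaceX) := by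
  have hsub : (⋃ k ∈ F, (fun t => pp t (k * Real.pi / 2 ^ j)) '' Ioo c d) ⊆
      Metric.ball x r ∩ spaceX := by
    intro y hy
    simp only [mem_iUnion, exists_prop] at hy
    obtain ⟨k, hk, s, hs, rfl⟩ := hy
    refine ⟨h k hk s hs, (mem_X _).2 ⟨j, hj, k, s, ?_, rfl⟩⟩
    rw [abs_of_pos (hc.trans_lt hs.1)]
    exact hs.2.le.trans hd
  refine le_trans (le_of_eq ?_) (measure_mono hsub)
  rw [measure_biUnion_finset]
  · simp only [pp_measure, Real.volume_Ioo, Finset.sum_const, nsmul_eq_mul]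
  · intro k hk l hl hkl
    rw [Function.onFun, Set.disjoint_left]
    rintro _ ⟨s, hs, rfl⟩ ⟨t, ht, hst⟩
    apply hkl
    have hst' : dist (pp t (l * Real.pi / 2 ^ j)) (pp s (k * Real.pi / 2 ^ j)) = 0 := by
      rw [dist_eq_zero]; exact hst
    have h0 := pp_dist_sq t s (l * Real.pi / 2 ^ j) (k * Real.pi / 2 ^ j)
    rw [hst'] at h0
    have hs0 : 0 < s := hc.trans_lt hs.1
    have ht0 : 0 < t := hc.trans_lt ht.1
    have hts : 0 < 2 * t * s := by positivity
    have hc1 := Real.cos_le_one (l * Real.pi / 2 ^ j - k * Real.pi / 2 ^ j)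
    have hcos : Real.cos (l * Real.pi / 2 ^ j - k * Real.pi / 2 ^ j) = 1 := by
      by_contra hne
      have := lt_of_le_of_ne hc1 hne
      nlinarith [sq_nonneg (t - s), mul_pos hts (sub_pos.2 this)]
    have hb := abs_lt.1 (hF l hl k hk)
    have hb1 : (-(2 * 2 ^ j) : ℝ) < l - k := by exact_mod_cast hb.1
    have hb2 : (l - k : ℝ) < 2 * 2 ^ j := by exact_mod_cast hb.2
    have hp : (0 : ℝ) < 2 ^ j := by positivity
    have he : (l * Real.pi / 2 ^ j - k * Real.pi / 2 ^ j : ℝ) = (l - k) * Real.pi / 2 ^ j := by ring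
    rw [he] at hcos
    rw [Real.cos_eq_one_iff_of_lt_of_lt] at hcos
    · have : (l - k : ℝ) = 0 := by
        have h3 := Real.pi_pos.ne'
        field_simp at hcos
        simpa using hcos
      have : (k : ℝ) = l := by linarith
      exact_mod_cast this
    · rw [lt_div_iff₀ hp]; nlinarith [Real.pi_pos]
    · rw [div_lt_iff₀ hp]; nlinarith [Real.pi_pos]
  · intro k _
    exact (pp_isometry _).isClosedEmbedding.measurableEmbedding.measurableSet_image.2 measurableSet_Ioo

/-- Tail bound. -/
lemma tail (i : ℕ) : μH[1] (⋃ l : ℕ, ⋃ k ∈ Finset.range (2 ^ (i + 1 + l)),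
    (fun t => pp t ((k : ℕ) * Real.pi / 2 ^ (i + 1 + l))) '' Icc (-aj (i + 1 + l)) (aj (i + 1 + l)))
    ≤ ENNReal.ofReal ((1 / 2) ^ i) := by
  have key : ∀ l : ℕ, μH[1] (⋃ k ∈ Finset.range (2 ^ (i + 1 + l)),
    (fun t => pp t ((k : ℕ) * Real.pi / 2 ^ (i + 1 + l))) '' Icc (-aj (i + 1 + l)) (aj (i + 1 + l)))
    ≤ ENNReal.ofReal ((1 / 2) ^ i * (1 / 2 / 2 ^ l)) := by
    intro l
    refine (measure_biUnion_finset_le _ _).trans (le_of_eq ?_)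
    simp only [pp_measure, Real.volume_Icc, Finset.sum_const, nsmul_eq_mul, Finset.card_range]
    rw [← ENNReal.ofReal_natCast, ← ENNReal.ofReal_mul (by positivity)]
    congr 1
    unfold aj
    push_cast
    have : (1 / 4 : ℝ) ^ (i + 1 + l) = (1/2) ^ (i + 1 + l) * (1/2) ^ (i + 1 + l) := by
      rw [← mul_pow]; norm_num
    rw [this]
    have h2 : (2 : ℝ) ^ (i + 1 + l) * (1/2) ^ (i + 1 + l) = 1 := by
      rw [← mul_pow]; norm_num
    calc _ = ((2 : ℝ) ^ (i + 1 + l) * (1/2) ^ (i + 1 + l)) * (1/2) ^ (i + 1 + l) := by ring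
      _ = _ := by rw [h2, pow_add, pow_add]; simp; ring
  refine (measure_iUnion_le _).trans ((ENNReal.tsum_le_tsum key).trans (le_of_eq ?_))
  have hs : HasSum (fun l : ℕ => ((1 : ℝ) / 2) ^ i * (1 / 2 / 2 ^ l)) ((1 / 2) ^ i * 1) :=
    (hasSum_geometric_two' 1).mul_left _
  rw [← ENNReal.ofReal_tsum_of_nonneg (fun _ => by positivity) hs.summable, hs.tsum_eq, mul_one]

lemma total : μH[1] spaceX ≤ 1 := by
  have h := tail 0
  simp only [pow_zero, ENNReal.ofReal_one] at h
  refine (measure_mono ?_).trans h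
  intro y hy
  obtain ⟨j, hj, k, hk, t, ht, rfl⟩ := (mem_X_nat y).1 hy
  obtain ⟨d, rfl⟩ := Nat.exists_eq_add_of_le hj
  simp only [mem_iUnion, exists_prop, Finset.mem_range]
  exact ⟨d, k, by simpa using hk, t, by simpa [mem_Icc] using abs_le.1 ht, by simp⟩

lemma upper0 (i : ℕ) (S : ℝ) (hS : 0 < S) : μH[1] (Metric.ball 0 S ∩ spaceX) ≤
    ENNReal.ofReal (2 ^ i * (2 * S) + (1 / 2) ^ i) := by
  have hsub : Metric.ball 0 S ∩ spaceX ⊆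
    (⋃ k ∈ Finset.range (2 ^ i), (fun t => pp t ((k : ℕ) * Real.pi / 2 ^ i)) '' Icc (-S) S) ∪
    (⋃ l : ℕ, ⋃ k ∈ Finset.range (2 ^ (i + 1 + l)),
    (fun t => pp t ((k : ℕ) * Real.pi / 2 ^ (i + 1 + l))) ''
      Icc (-aj (i + 1 + l)) (aj (i + 1 + l))) := by
    rintro y ⟨hyb, hy⟩
    obtain ⟨j, hj, k, hk, t, ht, rfl⟩ := (mem_X_nat y).1 hy
    rw [Metric.mem_ball, pp_norm_dist] at hyb
    rcases le_or_gt j i with hji | hji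
    · left
      obtain ⟨k', hk'⟩ := angle_lift hji k
      obtain ⟨t', m, hm, h1, h2⟩ := pp_reduce t i k'
      simp only [mem_iUnion, exists_prop, Finset.mem_range]
      refine ⟨m, hm, t', abs_le.1 (h1 ▸ hyb.le), ?_⟩
      simp only
      rw [← h2, ← hk']; simp
    · right
      obtain ⟨d, rfl⟩ := Nat.exists_eq_add_of_le (Nat.succ_le_of_lt hji)
      simp only [mem_iUnion, exists_prop, Finset.mem_range]
      exact ⟨d, k, hk, t, abs_le.1 ht, rfl⟩
  refine (measure_mono hsub).trans ((measure_union_le _ _).trans ?_)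
  rw [ENNReal.ofReal_add (by positivity) (by positivity)]
  refine add_le_add ?_ (tail i)
  refine (measure_biUnion_finset_le _ _).trans (le_of_eq ?_)
  simp only [pp_measure, Real.volume_Icc, Finset.sum_const, nsmul_eq_mul, Finset.card_range]
  rw [← ENNReal.ofReal_natCast, ← ENNReal.ofReal_mul (by positivity)]
  congr 1
  push_cast; ring

lemma lower1 (j : ℕ) (hj : 1 ≤ j) (R r : ℝ) (k0 : ℤ) (hR : R ≤ aj j) (hr : 0 < r) (hrR : r ≤ R) :
    ∃ N : ℝ, 1 ≤ N ∧ 2 ^ j * r / R / 8 ≤ N ∧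
      ENNReal.ofReal (N * (r / 2)) ≤
        μH[1] (Metric.ball (pp R (k0 * Real.pi / 2 ^ j)) r ∩ spaceX) := by
  have hR0 : 0 < R := hr.trans_le hrR
  have hp : (0 : ℝ) < 2 ^ j := by positivity
  set M : ℕ := ⌊2 ^ j * r / R / 8⌋₊ with hM
  have hM1 : (M : ℝ) ≤ 2 ^ j * r / R / 8 := Nat.floor_le (by positivity)
  have hM2 : 2 ^ j * r / R / 8 < M + 1 := Nat.lt_floor_add_one _
  have hM3 : (M : ℝ) * (8 * R) ≤ 2 ^ j * r := by
    rw [div_div, le_div_iff₀ (by positivity)] at hM1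
    linarith
  have hM4 : (M : ℝ) * 8 ≤ 2 ^ j := by
    refine le_of_mul_le_mul_right ?_ hR0
    nlinarith
  refine ⟨2 * M + 1, by linarith [Nat.cast_nonneg (α := ℝ) M],
    by linarith [Nat.cast_nonneg (α := ℝ) M], ?_⟩
  have h := lower j hj (Finset.Icc (k0 - M) (k0 + M)) ?_ (R - r / 2) R (by linarith) hR
    (pp R (k0 * Real.pi / 2 ^ j)) r ?_
  · refine le_trans (le_of_eq ?_) h
    rw [Int.card_Icc, ← ENNReal.ofReal_natCast, ← ENNReal.ofReal_mul (by positivity)]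
    have : (k0 + M + 1 - (k0 - M)).toNat = 2 * M + 1 := by omega
    rw [this]
    congr 1
    push_cast; ring
  · intro k hk l hl
    rw [Finset.mem_Icc] at hk hl
    have h8 : (M : ℤ) * 8 ≤ 2 ^ j := by exact_mod_cast hM4
    have hpz : (0 : ℤ) < 2 ^ j := by positivity
    rw [abs_lt]
    constructor <;> linarith [hk.1, hk.2, hl.1, hl.2, Nat.cast_nonneg (α := ℤ) M]
  · intro k hk s hs
    rw [Finset.mem_Icc] at hk
    rw [Metric.mem_ball]
    refine lt_of_pow_lt_pow_left₀ 2 hr.le ?_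
    rw [pp_dist_sq]
    have hkm : |(k : ℝ) - k0| ≤ M := by
      rw [abs_le]
      have h1 : ((k0 - M : ℤ) : ℝ) ≤ k := by exact_mod_cast hk.1
      have h2 : (k : ℝ) ≤ ((k0 + M : ℤ) : ℝ) := by exact_mod_cast hk.2
      push_cast at h1 h2
      constructor <;> linarith
    set δ : ℝ := k * Real.pi / 2 ^ j - k0 * Real.pi / 2 ^ j with hδ
    have hδ' : δ = (k - k0) * Real.pi / 2 ^ j := by rw [hδ]; ring
    have hRδ : R * |δ| ≤ r / 2 := by
      rw [hδ', abs_div, abs_mul, abs_of_pos hp, abs_of_pos Real.pi_pos, ← mul_div_assoc,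
        div_le_iff₀ hp]
      have hpi : Real.pi ≤ 4 := Real.pi_le_four
      calc R * (|(k : ℝ) - k0| * Real.pi) ≤ R * (M * 4) := by gcongr
        _ ≤ _ := by linarith
    have hcos := Real.one_sub_sq_div_two_le_cos (x := δ)
    have hs0 : 0 < s := by linarith [hs.1]
    have e1 : (s - R) ^ 2 < (r / 2) ^ 2 := by
      apply sq_lt_sq'
      · linarith [hs.1]
      · linarith [hs.2]
    have e2 : (R * |δ|) ^ 2 ≤ (r / 2) ^ 2 := by gcongr
    rw [mul_pow, sq_abs] at e2
    have e3 : 2 * s * R * (1 - Real.cos δ) ≤ 2 * R * R * (δ ^ 2 / 2) := by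
      have : 0 ≤ 1 - Real.cos δ := by linarith [Real.cos_le_one δ]
      gcongr
      · exact hs.2.le
      · linarith
    nlinarith

lemma line_ball (θ : ℝ) (x : E2) (ρ : ℝ) (hρ : 0 ≤ ρ) :
    μH[1] ((fun t => pp t θ) '' {t | pp t θ ∈ Metric.ball x ρ}) ≤ ENNReal.ofReal (2 * ρ) := by
  rw [pp_measure]
  refine (Real.volume_le_diam _).trans ?_
  refine Metric.ediam_le_of_forall_dist_le ?_
  intro s hs t ht
  rw [← (pp_isometry θ).dist_eq]
  simp only [mem_setOf_eq, Metric.mem_ball] at hs ht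
  have := dist_triangle_right (pp s θ) (pp t θ) x
  linarith

lemma upper1 (j : ℕ) (R r : ℝ) (k0 : ℤ) (hR1 : aj (j + 1) < R)
    (hr : 0 < r) (hrR : r ≤ R / 4) :
    μH[1] (Metric.ball (pp R (k0 * Real.pi / 2 ^ j)) (2 * r) ∩ spaceX) ≤
      ENNReal.ofReal ((4 * (2 ^ j * r / R) + 1) * (4 * r)) := by
  have hR0 : 0 < R := (aj_pos _).trans hR1
  have hp : (0 : ℝ) < 2 ^ (j + 1) := by positivity
  set x := pp R (k0 * Real.pi / 2 ^ j) with hx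
  set M : ℕ := ⌊2 ^ (j + 1) * r / R⌋₊ with hM
  have hM1 : (M : ℝ) ≤ 2 ^ (j + 1) * r / R := Nat.floor_le (by positivity)
  obtain ⟨k1, hk1⟩ := angle_lift (Nat.le_succ j) k0
  have hsub : Metric.ball x (2 * r) ∩ spaceX ⊆ ⋃ m ∈ Finset.Icc (-(M : ℤ)) M,
      (fun t => pp t ((k1 + m : ℤ) * Real.pi / 2 ^ (j + 1))) ''
        {t | pp t ((k1 + m : ℤ) * Real.pi / 2 ^ (j + 1)) ∈ Metric.ball x (2 * r)} := by
    rintro y ⟨hyb, hy⟩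
    obtain ⟨i, hi, k, t, ht, rfl⟩ := (mem_X y).1 hy
    have htR : R / 2 < |t| := by
      have h1 := dist_triangle x (pp t (k * Real.pi / 2 ^ i)) 0
      rw [pp_norm_dist, hx, pp_norm_dist, ← hx, abs_of_pos hR0] at h1
      rw [Metric.mem_ball, dist_comm] at hyb
      linarith
    have hij : i ≤ j + 1 := by
      by_contra hlt
      have h1 := aj_anti (show j + 1 + 1 ≤ i by omega)
      have h2 : aj (j + 1 + 1) = aj (j + 1) / 4 := by unfold aj; rw [pow_succ]; ring
      have := aj_pos (j + 1)
      linarith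
    obtain ⟨k', hk'⟩ := angle_lift hij k
    rw [hk'] at hyb ⊢
    set q : ℤ := round (((k' - k1 : ℤ) : ℝ) / 2 ^ (j + 1)) with hq
    set m : ℤ := k' - k1 - q * 2 ^ (j + 1) with hm
    have hmabs : |(m : ℝ)| ≤ 2 ^ (j + 1) / 2 := by
      have h1 := abs_sub_round (((k' - k1 : ℤ) : ℝ) / 2 ^ (j + 1))
      rw [← hq] at h1
      have h2 : (m : ℝ) = (((k' - k1 : ℤ) : ℝ) / 2 ^ (j + 1) - q) * 2 ^ (j + 1) := by
        rw [hm]; push_cast; field_simp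
      rw [h2, abs_mul, abs_of_pos hp]
      nlinarith
    obtain ⟨t', -, h2⟩ := pp_int t ((k1 + m : ℤ) * Real.pi / 2 ^ (j + 1)) q
    have h3 : ((k1 + m : ℤ) : ℝ) * Real.pi / 2 ^ (j + 1) + q * Real.pi =
        k' * Real.pi / 2 ^ (j + 1) := by
      rw [hm]; push_cast; field_simp; ring
    rw [h3] at h2
    rw [h2] at hyb ⊢
    simp only [mem_iUnion, exists_prop]
    refine ⟨m, ?_, t', hyb, rfl⟩
    rw [Metric.mem_ball, hx, hk1] at hyb
    have hd := pp_dist_sq t' R ((k1 + m : ℤ) * Real.pi / 2 ^ (j + 1)) (k1 * Real.pi / 2 ^ (j + 1))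
    have he : ((k1 + m : ℤ) * Real.pi / 2 ^ (j + 1) - k1 * Real.pi / 2 ^ (j + 1) : ℝ) =
        m * Real.pi / 2 ^ (j + 1) := by push_cast; ring
    rw [he] at hd
    set δ : ℝ := m * Real.pi / 2 ^ (j + 1) with hδ
    have hδabs : |δ| = |(m : ℝ)| * Real.pi / 2 ^ (j + 1) := by
      rw [hδ, abs_div, abs_mul, abs_of_pos hp, abs_of_pos Real.pi_pos]
    have hsin : 2 / Real.pi * |δ| ≤ |Real.sin δ| := by
      apply Real.mul_abs_le_abs_sin
      rw [hδabs, div_le_iff₀ hp]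
      nlinarith [Real.pi_pos]
    have hsq : (R * |Real.sin δ|) ^ 2 < (2 * r) ^ 2 := by
      have h4 : (R * |Real.sin δ|) ^ 2 ≤
          dist (pp t' ((k1 + m : ℤ) * Real.pi / 2 ^ (j + 1)))
            (pp R (k1 * Real.pi / 2 ^ (j + 1))) ^ 2 := by
        rw [hd, mul_pow, sq_abs, Real.sin_sq]
        nlinarith [sq_nonneg (t' - R * Real.cos δ)]
      refine h4.trans_lt ?_
      gcongr
    have hlt := lt_of_pow_lt_pow_left₀ 2 (by positivity) hsq
    have h5 : R * (2 / Real.pi * |δ|) < 2 * r := (by gcongr : _ ≤ R * |Real.sin δ|).trans_lt hlt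
    have h6 : |(m : ℝ)| ≤ 2 ^ (j + 1) * r / R := by
      rw [hδabs] at h5
      have hpi := Real.pi_pos
      have h7 : R * (2 / Real.pi * (|(m : ℝ)| * Real.pi / 2 ^ (j + 1))) =
        2 * (R * |(m : ℝ)| / 2 ^ (j + 1)) := by field_simp
      rw [h7] at h5
      have h8 : R * |(m : ℝ)| / 2 ^ (j + 1) < r := by linarith
      rw [div_lt_iff₀ hp] at h8
      rw [le_div_iff₀ hR0]
      linarith
    have h9 : m.natAbs ≤ M := by
      apply Nat.le_floor
      rwa [Nat.cast_natAbs, Int.cast_abs]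
    rw [Finset.mem_Icc]
    omega
  refine (measure_mono hsub).trans ((measure_biUnion_finset_le _ _).trans ?_)
  refine (Finset.sum_le_sum fun m _ => line_ball _ x (2 * r) (by positivity)).trans ?_
  rw [Finset.sum_const, nsmul_eq_mul, Int.card_Icc, ← ENNReal.ofReal_natCast,
    ← ENNReal.ofReal_mul (by positivity)]
  apply ENNReal.ofReal_le_ofReal
  have : ((M : ℤ) + 1 - (-(M : ℤ))).toNat = 2 * M + 1 := by omega
  rw [this]
  have h10 : (2 : ℝ) ^ (j + 1) * r / R = 2 * (2 ^ j * r / R) := by rw [pow_succ]; ring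
  rw [h10] at hM1
  push_cast
  nlinarith

lemma lower0 (j : ℕ) (hj : 1 ≤ j) (S : ℝ) (hS : aj j ≤ S) :
    ENNReal.ofReal ((1 / 2) ^ j / 2) ≤ μH[1] (Metric.ball 0 S ∩ spaceX) := by
  have h := lower j hj (Finset.Ico 0 (2 ^ j)) ?_ 0 (aj j) le_rfl le_rfl 0 S ?_
  · refine le_trans (le_of_eq ?_) h
    rw [Int.card_Ico, ← ENNReal.ofReal_natCast, ← ENNReal.ofReal_mul (by positivity)]
    have : ((2 : ℤ) ^ j - 0).toNat = 2 ^ j := by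
      rw [sub_zero]; exact_mod_cast Int.toNat_natCast (2 ^ j)
    rw [this]
    congr 1
    unfold aj
    push_cast
    rw [sub_zero, mul_div_assoc', ← mul_pow]; norm_num
  · intro k hk l hl
    rw [Finset.mem_Ico] at hk hl
    rw [abs_lt]
    constructor <;> linarith [hk.1, hk.2, hl.1, hl.2]
  · intro k _ s hs
    rw [Metric.mem_ball, pp_norm_dist, abs_of_pos hs.1]
    exact hs.2.trans_le hS

lemma finish {u l : ℝ} {p q : ℝ≥0∞} (h1 : p ≤ ENNReal.ofReal u) (h2 : ENNReal.ofReal l ≤ q)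
    (h : u ≤ 2 ^ 18 * l) : p ≤ 2 ^ 18 * q := by
  refine h1.trans ((ENNReal.ofReal_le_ofReal h).trans ?_)
  rw [ENNReal.ofReal_mul (by positivity)]
  have : ENNReal.ofReal (2 ^ 18) = 2 ^ 18 := by
    rw [ENNReal.ofReal_pow (by norm_num)]; simp
  rw [this]
  gcongr

lemma exists_aj_le (S : ℝ) (hS : 0 < S) : ∃ j, aj j < S := by
  obtain ⟨n, hn⟩ := exists_pow_lt_of_lt_one hS (by norm_num : (1 / 4 : ℝ) < 1)
  exact ⟨n, by unfold aj; have : (0:ℝ) < (1/4)^n := by positivity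
               linarith⟩

/-- polar form of a nonzero point of X at its natural level -/
lemma polar (x : E2) (hx : x ∈ spaceX) (hx0 : 0 < dist x 0) :
    ∃ j : ℕ, 1 ≤ j ∧ ∃ k : ℤ, aj (j + 1) < dist x 0 ∧ dist x 0 ≤ aj j ∧
      x = pp (dist x 0) (k * Real.pi / 2 ^ j) := by
  obtain ⟨i, hi, k, t, ht, rfl⟩ := (mem_X x).1 hx
  rw [pp_norm_dist] at hx0 ⊢
  classical
  have hex := exists_aj_le |t| hx0
  obtain ⟨hn1, hn2⟩ : aj (Nat.find hex) < |t| ∧ ∀ m < Nat.find hex, ¬ aj m < |t| :=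
    ⟨Nat.find_spec hex, fun m hm => Nat.find_min hex hm⟩
  generalize Nat.find hex = n at hn1 hn2
  have hin : i < n := by
    by_contra h
    have := aj_anti (not_lt.1 h)
    linarith
  obtain ⟨j, rfl⟩ : ∃ j, n = j + 1 := ⟨n - 1, by omega⟩
  obtain ⟨k', hk'⟩ := angle_lift (show i ≤ j by omega) k
  rw [hk']
  refine ⟨j, by omega, ?_⟩
  rcases le_total 0 t with h | h
  · exact ⟨k', hn1, not_lt.1 (hn2 j (by omega)), by rw [abs_of_nonneg h]⟩
  · refine ⟨k' + 2 ^ j, hn1, not_lt.1 (hn2 j (by omega)), ?_⟩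
    rw [abs_of_nonpos h, pp_neg]
    have : ((k' + 2 ^ j : ℤ) : ℝ) * Real.pi / 2 ^ j + Real.pi =
      k' * Real.pi / 2 ^ j + (2 : ℤ) * Real.pi := by push_cast; field_simp; ring
    rw [this]
    unfold pp
    rw [Real.cos_add_int_mul_pi, Real.sin_add_int_mul_pi]
    norm_num

lemma pow_facts (j : ℕ) : (2 : ℝ) ^ j * (1 / 4) ^ j = (1 / 2) ^ j := by
  rw [← mul_pow]; norm_num

/-- The measure `ℋ¹` restricted to `X ⊂ ℝ²` (with the Euclidean metric) is doubling,
with doubling constant `2^18`. -/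
theorem stmt18 :
    ∀ x ∈ spaceX, ∀ r : ℝ, 0 < r →
      μH[1] (Metric.ball x (2 * r) ∩ spaceX) ≤ 2 ^ 18 * μH[1] (Metric.ball x r ∩ spaceX) := by
  intro x hx r hr
  rcases le_or_gt (2 * dist x 0) r with hbig | hsmall
  · -- the ball contains a ball around the origin
    have hsub1 : Metric.ball 0 (r / 2) ⊆ Metric.ball x r := by
      apply Metric.ball_subset_ball'
      rw [dist_comm]; linarith
    have hsub2 : Metric.ball x (2 * r) ⊆ Metric.ball 0 (6 * r) := by
      apply Metric.ball_subset_ball'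
      linarith
    have hmono := measure_mono (μ := μH[1]) (inter_subset_inter_left spaceX hsub1)
    rcases le_or_gt (aj 1) (r / 2) with h1 | h1
    · refine finish (u := 1) ?_ ((lower0 1 le_rfl _ h1).trans hmono) (by norm_num)
      rw [ENNReal.ofReal_one]
      exact (measure_mono inter_subset_right).trans total
    · classical
      have hex := exists_aj_le (r / 2) (by linarith)
      obtain ⟨hn1, hn2⟩ : aj (Nat.find hex) < r / 2 ∧ ∀ m < Nat.find hex, ¬ aj m < r / 2 :=
        ⟨Nat.find_spec hex, fun m hm => Nat.find_min hex hm⟩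
      generalize Nat.find hex = n at hn1 hn2
      have hn : 1 < n := by
        by_contra h
        have := aj_anti (not_lt.1 h)
        linarith
      obtain ⟨j, rfl⟩ : ∃ j, n = j + 1 := ⟨n - 1, by omega⟩
      have hrj := not_lt.1 (hn2 j (by omega))
      refine finish
        ((measure_mono (inter_subset_inter_left spaceX hsub2)).trans (upper0 j (6 * r) (by linarith)))
        ((lower0 (j + 1) (by omega) _ hn1.le).trans hmono) ?_
      have h2 : (2 : ℝ) ^ j * r ≤ 2 ^ j * (1 / 4) ^ j := by
        unfold aj at hrj
        gcongr
        linarith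
      rw [pow_facts] at h2
      have h3 : (0 : ℝ) < (1 / 2) ^ j := by positivity
      rw [pow_succ (1 / 2 : ℝ) j]
      linarith
  · have hx0 : 0 < dist x 0 := by linarith
    obtain ⟨j, hj, k, hj1, hj2, hxe⟩ := polar x hx hx0
    set R := dist x 0 with hR
    rcases le_or_gt r (R / 4) with h4 | h4
    · obtain ⟨N, hN1, hN2, hN⟩ := lower1 j hj R r k hj2 hr (by linarith)
      have hup := upper1 j R r k hj1 hr h4
      rw [← hxe] at hN hup
      refine finish hup hN ?_
      have : 4 * (2 ^ j * r / R) + 1 ≤ 33 * N := by linarith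
      nlinarith
    · obtain ⟨N, hN1, hN2, hN⟩ := lower1 j hj R (R / 4) k hj2 (by linarith) (by linarith)
      rw [← hxe] at hN
      have hsub2 : Metric.ball x (2 * r) ⊆ Metric.ball 0 (6 * r) := by
        apply Metric.ball_subset_ball'
        rw [← hR]
        linarith
      refine finish
        ((measure_mono (inter_subset_inter_left spaceX hsub2)).trans (upper0 j (6 * r) (by linarith)))
        (hN.trans (measure_mono (inter_subset_inter_left spaceX
          (Metric.ball_subset_ball h4.le)))) ?_
      have e1 : (2 : ℝ) ^ j * (R / 4) / R / 8 = 2 ^ j / 32 := by field_simp; norm_num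
      rw [e1] at hN2
      unfold aj at hj1 hj2
      have h2 : (2 : ℝ) ^ j * r ≤ 2 ^ j * (1 / 4) ^ j := by
        gcongr
        linarith
      rw [pow_succ] at hj1
      have h3 : (2 : ℝ) ^ j * ((1 / 4) ^ j / 8) ≤ 2 ^ j * R := by
        gcongr
        linarith
      have h5 : (2 : ℝ) ^ j / 32 * (R / 4 / 2) ≤ N * (R / 4 / 2) := by gcongr
      have h6 := pow_facts j
      have h7 : (0 : ℝ) < (1 / 2) ^ j := by positivity
      linarith
end

section
/- For j ∈ ℕ and 0 ≤ k ≤ 2^j − 1 let I_k^j := {(t cos(kπ/2^j), t sin(kπ/2^j)) ∈ ℝ² : t ∈ [−1,1]}, let A_j := ⋃_{k=0}^{2^j−1} I_k^j, and let X := ⋃_{j=1}^∞ 2^{−2j−1}A_j ⊂ ℝ², where aA := {(ax,ay) : (x,y) ∈ A}. Equip X with the metric inherited from ℝ² and the measure ℋ¹ restricted to X, and let E := ⋃_{j=1}^∞ 2^{−2j−1}I_1^j. Then: (i) the measure-theoretic boundary ∂*E is empty; (ii) pV(χ_E,X) = 1; yet (iii) ‖Dχ_E‖(X) = ∞, i.e.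 E is not a set of finite perimeter in X. In particular, the implication 'ℋ(∂*E) < ∞ ⟹ E has finite perimeter' of Federer's characterization fails for this doubling space without a Poincaré inequality. -/
open MeasureTheory Set Filter Topology ENNReal

/-- A rectifiable curve parametrized by arc length: a map defined (in effect) on `[0, len]`
whose variation on every subinterval `[s,t] ⊆ [0,len]` equals `t - s`. -/
structure MCurve (X : Type*) [MetricSpace X] where
  len : ℝ
  len_nonneg : 0 ≤ len
  toFun : ℝ → X
  arclength : ∀ s t : ℝ, s ∈ Set.Icc 0 len → t ∈ Set.Icc 0 len → s ≤ t →
    eVariationOn toFun (Set.Icc s t) = ENNReal.ofReal (t - s)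

namespace MCurve

variable {X : Type*} [MetricSpace X]

/-- The image of a curve. -/
def image (γ : MCurve X) : Set X := γ.toFun '' Set.Icc 0 γ.len

/-- A curve is simple (injective) if its parametrization is injective on `[0, len]`. -/
def IsSimple (γ : MCurve X) : Prop := Set.InjOn γ.toFun (Set.Icc 0 γ.len)

end MCurve

/-- Pointwise variation `pV(v, X)`: supremum over finite collections of pairwise disjoint
injective arc-length parametrized curves of the sums of endpoint differences. -/
noncomputable def pVar {X : Type*} [MetricSpace X] (v : X → ℝ) : ℝ≥0∞ :=
  ⨆ (n : ℕ) (γ : Fin n → MCurve X) (_ : ∀ i, (γ i).IsSimple)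
    (_ : ∀ i j, i ≠ j → Disjoint (γ i).image (γ j).image),
    ∑ i, ENNReal.ofReal |v ((γ i).toFun (γ i).len) - v ((γ i).toFun 0)|

/-- Pointwise variation `pV_D(v, X)` with curve endpoints restricted to lie in `D`. -/
noncomputable def pVarOn {X : Type*} [MetricSpace X] (D : Set X) (v : X → ℝ) : ℝ≥0∞ :=
  ⨆ (n : ℕ) (γ : Fin n → MCurve X) (_ : ∀ i, (γ i).IsSimple)
    (_ : ∀ i j, i ≠ j → Disjoint (γ i).image (γ j).image)
    (_ : ∀ i, (γ i).toFun 0 ∈ D ∧ (γ i).toFun (γ i).len ∈ D),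
    ∑ i, ENNReal.ofReal |v ((γ i).toFun (γ i).len) - v ((γ i).toFun 0)|

/-- `Var(u, X)`: infimum of `pV(v, X)` over representatives `v = u` a.e. -/
noncomputable def VarH {X : Type*} [MetricSpace X] [MeasurableSpace X]
    (μ : Measure X) (u : X → ℝ) : ℝ≥0∞ :=
  ⨅ (v : X → ℝ) (_ : v =ᵐ[μ] u), pVar v

/-- `g` is an upper gradient of `u`: `g` is Borel and the upper gradient inequality holds
along every arc-length parametrized rectifiable curve. -/
def IsUpperGradient {X : Type*} [MetricSpace X] [MeasurableSpace X]
    (u : X → ℝ) (g : X → ℝ≥0∞) : Prop :=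
  Measurable g ∧ ∀ γ : MCurve X,
    ENNReal.ofReal |u (γ.toFun γ.len) - u (γ.toFun 0)| ≤ ∫⁻ s in Set.Icc 0 γ.len, g (γ.toFun s)

/-- The total variation `‖Du‖(X)`: infimum of `liminf ∫ gᵢ dμ` over sequences `uᵢ → u` in
`L¹(X, μ)` with upper gradients `gᵢ`. -/
noncomputable def totalVarH {X : Type*} [MetricSpace X] [MeasurableSpace X]
    (μ : Measure X) (u : X → ℝ) : ℝ≥0∞ :=
  ⨅ (ui : ℕ → X → ℝ) (gi : ℕ → X → ℝ≥0∞) (_ : ∀ i, IsUpperGradient (ui i) (gi i))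
    (_ : Filter.Tendsto (fun i => ∫⁻ x, ENNReal.ofReal |ui i x - u x| ∂μ)
      Filter.atTop (nhds 0)),
    Filter.atTop.liminf (fun i => ∫⁻ x, gi i x ∂μ)

/-- The set `E = ⋃_{j≥1} 2^{-2j-1} I_1^j`. -/
noncomputable def setE : Set E2 :=
  ⋃ (j : ℕ) (_ : 1 ≤ j), scaleSet ((2 : ℝ) ^ (-(2 * (j : ℤ)) - 1)) (segIkj j 1)

/-- The characteristic function of `E`, viewed as a function on the space `X`. -/
noncomputable def chiE : spaceX → ℝ :=
  Set.indicator {p : spaceX | (p : E2) ∈ setE} (fun _ => (1 : ℝ))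

/-- The measure-theoretic boundary `∂*E` of `E` in `X`, defined via Euclidean balls. -/
noncomputable def mtBoundary : Set spaceX :=
  {x : spaceX |
    0 < Filter.limsup
        (fun r : ℝ => μH[1] (Metric.ball (x : E2) r ∩ setE)
          / μH[1] (Metric.ball (x : E2) r ∩ spaceX)) (𝓝[>] 0) ∧
    0 < Filter.limsup
        (fun r : ℝ => μH[1] ((Metric.ball (x : E2) r ∩ spaceX) \ setE)
          / μH[1] (Metric.ball (x : E2) r ∩ spaceX)) (𝓝[>] 0)}

namespace Fed

noncomputable def dir (θ : ℝ) : E2 := !₂[Real.cos θ, Real.sin θ]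

noncomputable def rad (j : ℕ) : ℝ := (2 : ℝ) ^ (-(2 * (j : ℤ)) - 1)

noncomputable def ang (j k : ℕ) : ℝ := k * Real.pi / 2 ^ j

noncomputable def seg (θ a : ℝ) : Set E2 := (fun t : ℝ => t • dir θ) '' Icc (-a) a

lemma norm_dir (θ : ℝ) : ‖dir θ‖ = 1 := by
  simp [dir, EuclideanSpace.norm_eq, Fin.sum_univ_two]

lemma norm_smul_dir (t θ : ℝ) : ‖t • dir θ‖ = |t| := by
  rw [norm_smul, norm_dir, mul_one, Real.norm_eq_abs]

lemma rad_pos (j : ℕ) : 0 < rad j := by unfold rad; positivity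

lemma rad_succ (j : ℕ) : rad (j + 1) = rad j / 4 := by
  unfold rad
  have : (-(2 * ((j + 1 : ℕ) : ℤ)) - 1) = (-(2 * (j : ℤ)) - 1) + (-2) := by push_cast; ring
  rw [this, zpow_add₀ (by norm_num)]
  norm_num
  ring

lemma rad_eq (j : ℕ) : rad j = (1 / 2) * (1 / 4) ^ j := by
  induction j with
  | zero => norm_num [rad]
  | succ n ih => rw [rad_succ, ih]; ring

lemma rad_anti : StrictAnti rad := by
  apply strictAnti_nat_of_succ_lt
  intro n
  rw [rad_succ]
  linarith [rad_pos n]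

lemma rad_tendsto : Tendsto rad atTop (𝓝 0) := by
  have : rad = fun j => (1 / 2 : ℝ) * (1 / 4) ^ j := funext rad_eq
  rw [this]
  simpa using (tendsto_pow_atTop_nhds_zero_of_lt_one (r := (1 / 4 : ℝ)) (by norm_num)
    (by norm_num)).const_mul (1 / 2 : ℝ)

lemma scale_seg (j k : ℕ) : scaleSet ((2 : ℝ) ^ (-(2 * (j : ℤ)) - 1)) (segIkj j k)
    = seg (ang j k) (rad j) := by
  have hr := rad_pos j
  change scaleSet (rad j) _ = _
  ext p
  simp only [scaleSet, segIkj, seg, mem_image, exists_exists_and_eq_and, mem_Icc]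
  constructor
  · rintro ⟨t, ⟨h1, h2⟩, rfl⟩
    refine ⟨rad j * t, ⟨by nlinarith, by nlinarith⟩, ?_⟩
    ext i; fin_cases i <;> simp [dir, ang] <;> ring
  · rintro ⟨t, ⟨h1, h2⟩, rfl⟩
    refine ⟨t / rad j, ⟨?_, ?_⟩, ?_⟩
    · rw [le_div_iff₀ hr]; linarith
    · rw [div_le_iff₀ hr]; linarith
    · ext i; fin_cases i <;> simp [dir, ang] <;> field_simp

lemma mem_E {p : E2} : p ∈ setE ↔ ∃ j, 1 ≤ j ∧ p ∈ seg (ang j 1) (rad j) := by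
  simp only [setE, scale_seg, mem_iUnion, exists_prop]

lemma mem_X {p : E2} : p ∈ spaceX ↔ ∃ j, 1 ≤ j ∧ ∃ k, k < 2 ^ j ∧ p ∈ seg (ang j k) (rad j) := by
  simp only [spaceX, setAj, mem_iUnion, exists_prop, ← scale_seg]
  refine exists_congr fun j => and_congr_right fun _ => ?_
  simp only [scaleSet, mem_image, mem_iUnion, exists_prop]
  constructor
  · rintro ⟨q, ⟨k, hk, hq⟩, rfl⟩
    exact ⟨k, hk, q, hq, rfl⟩
  · rintro ⟨k, hk, q, hq, rfl⟩
    exact ⟨q, ⟨k, hk, hq⟩, rfl⟩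

lemma E_sub_X : setE ⊆ spaceX := by
  intro p hp
  obtain ⟨j, hj, h⟩ := mem_E.1 hp
  exact mem_X.2 ⟨j, hj, 1, Nat.one_lt_two_pow (by omega), h⟩

lemma isCompact_seg (θ a : ℝ) : IsCompact (seg θ a) :=
  isCompact_Icc.image (by fun_prop)

lemma norm_le_of_seg {θ a : ℝ} {p : E2} (h : p ∈ seg θ a) : ‖p‖ ≤ a := by
  obtain ⟨t, ht, rfl⟩ := h
  simp only [norm_smul_dir]
  exact abs_le.2 ht

lemma seg_mono {θ a b : ℝ} (h : a ≤ b) : seg θ a ⊆ seg θ b :=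
  image_mono (Icc_subset_Icc (by linarith) h)

lemma ang_mem {j k : ℕ} (hk : k < 2 ^ j) : 0 ≤ ang j k ∧ ang j k < Real.pi := by
  have hp := Real.pi_pos
  unfold ang
  refine ⟨by positivity, ?_⟩
  rw [div_lt_iff₀ (by positivity), mul_comm]
  have : (k : ℝ) < 2 ^ j := by exact_mod_cast hk
  nlinarith

lemma ang_eq {j k i l : ℕ} (h : ang j k = ang i l) : k * 2 ^ i = l * 2 ^ j := by
  have hp := Real.pi_pos
  unfold ang at h
  rw [div_eq_div_iff (by positivity) (by positivity)] at h
  have : Real.pi * ((k : ℝ) * 2 ^ i) = Real.pi * (l * 2 ^ j) := by linarith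
  have := mul_left_cancel₀ hp.ne' this
  exact_mod_cast this

lemma angle_unique {θ φ s t : ℝ} (hθ : 0 ≤ θ ∧ θ < Real.pi) (hφ : 0 ≤ φ ∧ φ < Real.pi)
    (hs : s ≠ 0) (h : s • dir θ = t • dir φ) : θ = φ := by
  have h0 : s * Real.cos θ = t * Real.cos φ := by
    simpa [dir] using congrArg (fun p : E2 => p 0) h
  have h1 : s * Real.sin θ = t * Real.sin φ := by
    simpa [dir] using congrArg (fun p : E2 => p 1) h
  have h2 : s * Real.sin (θ - φ) = 0 := by
    rw [Real.sin_sub]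
    linear_combination Real.cos φ * h1 - Real.sin φ * h0
  have h3 : Real.sin (θ - φ) = 0 := by
    rcases mul_eq_zero.1 h2 with h | h
    · exact absurd h hs
    · exact h
  have := (Real.sin_eq_zero_iff_of_lt_of_lt (by linarith) (by linarith)).1 h3
  linarith

/-- local constancy away from the origin -/
lemma local_const {x : E2} (hx0 : x ≠ 0) :
    ∃ δ > 0, (Metric.ball x δ ∩ spaceX ⊆ setE) ∨ (Metric.ball x δ ∩ setE = ∅) := by
  have hn : 0 < ‖x‖ := norm_pos_iff.2 hx0
  obtain ⟨N, hN⟩ := (rad_tendsto.eventually (gt_mem_nhds hn)).exists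
  have hopen : IsOpen {y : E2 | rad N < ‖y‖} := isOpen_lt continuous_const continuous_norm
  by_cases hE : x ∈ setE
  · set K : Set E2 := ⋃ j ∈ {j | j ∈ Finset.range N ∧ 1 ≤ j},
      ⋃ k ∈ {k | k ∈ Finset.range (2 ^ j) ∧ ¬ seg (ang j k) (rad j) ⊆ setE},
        seg (ang j k) (rad j) with hK
    have hKc : IsClosed K := by
      refine Set.Finite.isClosed_biUnion ((Finset.range N).finite_toSet.subset
        fun j hj => hj.1) fun j _ => ?_
      refine Set.Finite.isClosed_biUnion ((Finset.range (2 ^ j)).finite_toSet.subset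
        fun j hj => hj.1) fun k _ => ?_
      exact (isCompact_seg _ _).isClosed
    have hxK : x ∉ K := by
      intro hxK
      simp only [hK, mem_iUnion, mem_ofPred_eq, exists_prop, Finset.mem_range] at hxK
      obtain ⟨j, ⟨hjN, hj⟩, k, ⟨hk, hns⟩, s, hs, hsx⟩ := hxK
      obtain ⟨i, hi, t, ht, htx⟩ := mem_E.1 hE
      simp only at hsx htx
      have hs0 : s ≠ 0 := by
        rintro rfl
        exact hx0 (by rw [← hsx, zero_smul])
      have hang := angle_unique (ang_mem hk) (ang_mem (Nat.one_lt_two_pow (by omega : i ≠ 0)))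
        hs0 (hsx.trans htx.symm)
      have hpow := ang_eq hang
      apply hns
      rw [hang]
      have hij : i ≤ j := by
        have hk1 : 1 ≤ k := by
          rcases Nat.eq_zero_or_pos k with h | h
          · subst h; simp at hpow; exact absurd hpow hk.ne
          · exact h
        have : 2 ^ i ≤ 2 ^ j := by nlinarith [Nat.pos_of_ne_zero (pow_ne_zero i (two_ne_zero (α := ℕ)))]
        exact (Nat.pow_le_pow_iff_right (by norm_num)).1 this
      intro y hy
      exact mem_E.2 ⟨i, hi, seg_mono (rad_anti.antitone hij) hy⟩
    obtain ⟨δ, hδ, hball⟩ := Metric.isOpen_iff.1 (hopen.inter hKc.isOpen_compl) x ⟨hN, hxK⟩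
    refine ⟨δ, hδ, Or.inl ?_⟩
    rintro y ⟨hy, hyX⟩
    obtain ⟨h1, h2⟩ := hball hy
    obtain ⟨j, hj, k, hk, hyj⟩ := mem_X.1 hyX
    by_contra hyE
    apply h2
    simp only [hK, mem_iUnion, mem_ofPred_eq, exists_prop, Finset.mem_range]
    refine ⟨j, ⟨?_, hj⟩, k, ⟨hk, fun h => hyE (h hyj)⟩, hyj⟩
    exact rad_anti.lt_iff_gt.1 (lt_of_lt_of_le h1 (norm_le_of_seg hyj))
  · set K : Set E2 := ⋃ j ∈ {j | j ∈ Finset.range N ∧ 1 ≤ j}, seg (ang j 1) (rad j) with hK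
    have hKc : IsClosed K := by
      refine Set.Finite.isClosed_biUnion ((Finset.range N).finite_toSet.subset
        fun j hj => hj.1) fun j _ => ?_
      exact (isCompact_seg _ _).isClosed
    have hxK : x ∉ K := by
      intro hxK
      simp only [hK, mem_iUnion, mem_ofPred_eq, exists_prop, Finset.mem_range] at hxK
      obtain ⟨j, ⟨hjN, hj⟩, h⟩ := hxK
      exact hE (mem_E.2 ⟨j, hj, h⟩)
    obtain ⟨δ, hδ, hball⟩ := Metric.isOpen_iff.1 (hopen.inter hKc.isOpen_compl) x ⟨hN, hxK⟩
    refine ⟨δ, hδ, Or.inr ?_⟩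
    rw [eq_empty_iff_forall_notMem]
    rintro y ⟨hy, hyE⟩
    obtain ⟨h1, h2⟩ := hball hy
    obtain ⟨j, hj, hyj⟩ := mem_E.1 hyE
    apply h2
    simp only [hK, mem_iUnion, mem_ofPred_eq, exists_prop, Finset.mem_range]
    exact ⟨j, ⟨rad_anti.lt_iff_gt.1 (lt_of_lt_of_le h1 (norm_le_of_seg hyj)), hj⟩, hyj⟩

/-- the open ray in direction `d` -/
def ray (d : E2) : Set E2 := {p | p = ‖p‖ • d} \ {0}

lemma measurableSet_ray (d : E2) : MeasurableSet (ray d) :=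
  (isClosed_eq continuous_id (by fun_prop)).measurableSet.diff (measurableSet_singleton 0)

lemma ray_disjoint {d e : E2} (h : d ≠ e) : Disjoint (ray d) (ray e) := by
  rw [Set.disjoint_left]
  rintro p ⟨h1, h0⟩ ⟨h2, -⟩
  apply h
  have : ‖p‖ ≠ 0 := norm_ne_zero_iff.2 h0
  exact smul_right_injective E2 this (h1.symm.trans h2)

lemma smul_mem_ray {t : ℝ} (ht : 0 < t) (θ : ℝ) : t • dir θ ∈ ray (dir θ) := by
  refine ⟨?_, ?_⟩
  · simp only [mem_ofPred_eq, norm_smul_dir, abs_of_pos ht]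
  · intro h
    have := norm_smul_dir t θ
    rw [h, norm_zero, abs_of_pos ht] at this
    exact ht.ne this

lemma dir_inj {θ φ : ℝ} (hθ : 0 ≤ θ ∧ θ < Real.pi) (hφ : 0 ≤ φ ∧ φ < Real.pi) (h : dir θ = dir φ) :
    θ = φ := angle_unique (s := 1) (t := 1) hθ hφ one_ne_zero (by rw [h])

/-- unit speed parametrization of a ray in the space -/
noncomputable def rc (θ L : ℝ) (hL : 0 ≤ L) (h : ∀ t ∈ Icc 0 L, t • dir θ ∈ spaceX) (s : ℝ) :
    spaceX :=
  ⟨(projIcc 0 L hL s : ℝ) • dir θ, h _ (projIcc 0 L hL s).2⟩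

lemma rc_coe {θ L : ℝ} {hL : 0 ≤ L} {h : ∀ t ∈ Icc 0 L, t • dir θ ∈ spaceX} {s : ℝ}
    (hs : s ∈ Icc 0 L) : (rc θ L hL h s : E2) = s • dir θ := by
  simp only [rc]
  rw [projIcc_of_mem hL hs]

lemma rc_cont {θ L : ℝ} {hL : 0 ≤ L} {h : ∀ t ∈ Icc 0 L, t • dir θ ∈ spaceX} :
    Continuous (rc θ L hL h) := by
  unfold rc
  exact Continuous.subtype_mk
    ((continuous_subtype_val.comp continuous_projIcc).smul continuous_const) _

lemma rc_edist {θ L : ℝ} {hL : 0 ≤ L} {h : ∀ t ∈ Icc 0 L, t • dir θ ∈ spaceX} {s t : ℝ}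
    (hs : s ∈ Icc 0 L) (ht : t ∈ Icc 0 L) : edist (rc θ L hL h s) (rc θ L hL h t) = edist s t := by
  rw [Subtype.edist_eq, rc_coe hs, rc_coe ht, edist_dist, edist_dist, dist_eq_norm, ← sub_smul,
    norm_smul_dir, Real.dist_eq]

noncomputable def rcCurve (θ L : ℝ) (hL : 0 ≤ L) (h : ∀ t ∈ Icc 0 L, t • dir θ ∈ spaceX)
    (l : ℝ) (hl : l ∈ Icc 0 L) : MCurve spaceX where
  len := l
  len_nonneg := hl.1
  toFun := rc θ L hL h
  arclength := by
    intro s t hs ht hst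
    have hs' : s ∈ Icc 0 L := ⟨hs.1, hs.2.trans hl.2⟩
    have ht' : t ∈ Icc 0 L := ⟨ht.1, ht.2.trans hl.2⟩
    apply le_antisymm
    · have hlip : LipschitzOnWith 1 (rc θ L hL h) (Icc s t) := by
        intro x hx y hy
        rw [rc_edist ⟨hs'.1.trans hx.1, hx.2.trans ht'.2⟩ ⟨hs'.1.trans hy.1, hy.2.trans ht'.2⟩]
        simp
      have h1 := hlip.comp_eVariationOn_le (g := (id : ℝ → ℝ)) (s := Icc s t) (mapsTo_id _)
      have h2 := (monotone_id (α := ℝ)).monotoneOn (Icc s t) |>.eVariationOn_eq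
        (left_mem_Icc.2 hst) (right_mem_Icc.2 hst)
      rw [Icc_inter_Icc] at h2
      simp only [sup_idem, inf_idem, id] at h2
      simp only [Function.comp_id, ENNReal.coe_one, one_mul] at h1
      exact h1.trans h2.le
    · have h1 := eVariationOn.edist_le (rc θ L hL h) (right_mem_Icc.2 hst) (left_mem_Icc.2 hst)
      rwa [rc_edist ht' hs', edist_dist, Real.dist_eq, abs_of_nonneg (by linarith)] at h1

lemma zero_mem_E : (0 : E2) ∈ setE :=
  mem_E.2 ⟨1, le_rfl, 0, ⟨by linarith [rad_pos 1], (rad_pos 1).le⟩, by simp⟩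

lemma ray_mem_X {j k : ℕ} (hj : 1 ≤ j) (hk : k < 2 ^ j) :
    ∀ t ∈ Icc 0 (rad j), t • dir (ang j k) ∈ spaceX := fun t ht =>
  mem_X.2 ⟨j, hj, k, hk, t, ⟨by linarith [ht.1, rad_pos j], ht.2⟩, rfl⟩

lemma three_lt {j : ℕ} (hj : 2 ≤ j) : 3 < 2 ^ j :=
  lt_of_lt_of_le (by norm_num : 3 < 2 ^ 2) (Nat.pow_le_pow_right (by norm_num) hj)

lemma three_notMem {j : ℕ} (hj : 2 ≤ j) {t : ℝ} (ht : t ≠ 0) : t • dir (ang j 3) ∉ setE := by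
  intro h
  obtain ⟨i, hi, s, hs, hst⟩ := mem_E.1 h
  have := ang_eq (angle_unique (ang_mem (three_lt hj))
    (ang_mem (Nat.one_lt_two_pow (by omega : i ≠ 0))) ht hst.symm)
  have h3 : 3 ∣ 2 ^ j := ⟨2 ^ i, by omega⟩
  have := Nat.Prime.dvd_of_dvd_pow Nat.prime_three h3
  omega

lemma chiE_of_mem {p : spaceX} (h : (p : E2) ∈ setE) : chiE p = 1 :=
  indicator_of_mem (s := {p : spaceX | (p : E2) ∈ setE}) h _

lemma chiE_of_notMem {p : spaceX} (h : (p : E2) ∉ setE) : chiE p = 0 :=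
  indicator_of_notMem (s := {p : spaceX | (p : E2) ∈ setE}) h _

lemma chiE_mem (p : spaceX) : chiE p ∈ ({0, 1} : Set ℝ) := by
  by_cases h : (p : E2) ∈ setE
  · simp [chiE_of_mem h]
  · simp [chiE_of_notMem h]

lemma chiE_cont {p : spaceX} (hp : (p : E2) ≠ 0) : ContinuousAt chiE p := by
  obtain ⟨δ, hδ, h⟩ := local_const hp
  have hb : Metric.ball p δ ∈ 𝓝 p := Metric.ball_mem_nhds p hδ
  have key : ∀ q ∈ Metric.ball p δ, chiE q = chiE p := by
    intro q hq
    have hpp : (p : E2) ∈ Metric.ball (p : E2) δ := Metric.mem_ball_self hδ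
    have hqq : (q : E2) ∈ Metric.ball (p : E2) δ := hq
    rcases h with h | h
    · rw [chiE_of_mem (h ⟨hpp, p.2⟩), chiE_of_mem (h ⟨hqq, q.2⟩)]
    · rw [eq_empty_iff_forall_notMem] at h
      rw [chiE_of_notMem fun h' => h _ ⟨hpp, h'⟩, chiE_of_notMem fun h' => h _ ⟨hqq, h'⟩]
  have : chiE =ᶠ[𝓝 p] fun _ => chiE p := by
    filter_upwards [hb] with q hq using key q hq
  exact continuousAt_const.congr this.symm

lemma curve_cont (γ : MCurve spaceX) : ContinuousOn γ.toFun (Icc 0 γ.len) := by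
  have key : ∀ x ∈ Icc 0 γ.len, ∀ y ∈ Icc 0 γ.len, x ≤ y →
      edist (γ.toFun x) (γ.toFun y) ≤ edist x y := by
    intro x hx y hy hxy
    have h1 := eVariationOn.edist_le γ.toFun (left_mem_Icc.2 hxy) (right_mem_Icc.2 hxy)
    rw [γ.arclength x y hx hy hxy] at h1
    rwa [edist_comm x y, edist_dist y x, Real.dist_eq, abs_of_nonneg (by linarith)]
  have : LipschitzOnWith 1 γ.toFun (Icc 0 γ.len) := by
    intro x hx y hy
    rw [ENNReal.coe_one, one_mul]
    rcases le_total x y with h | h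
    · exact key x hx y hy h
    · rw [edist_comm, edist_comm x y]
      exact key y hy x hx h
  exact this.continuousOn

lemma curve_const (γ : MCurve spaceX) (h : ∀ p ∈ γ.image, (p : E2) ≠ 0) :
    chiE (γ.toFun γ.len) = chiE (γ.toFun 0) := by
  have hc : ContinuousOn (fun s => chiE (γ.toFun s)) (Icc 0 γ.len) := by
    intro s hs
    exact (chiE_cont (h _ ⟨s, hs, rfl⟩)).comp_continuousWithinAt (curve_cont γ s hs)
  have hfin : ({0, 1} : Set ℝ).Finite := by simp
  obtain ⟨y, -, hy⟩ := isPreconnected_Icc.eqOn_const_of_mapsTo (T := ({0, 1} : Set ℝ))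
    hfin.isDiscrete hc (fun s _ => chiE_mem _) ⟨0, by simp⟩
  have h1 := hy (right_mem_Icc.2 γ.len_nonneg)
  have h2 := hy (left_mem_Icc.2 γ.len_nonneg)
  exact h1.trans h2.symm

lemma abs_chi_le (p q : spaceX) : |chiE p - chiE q| ≤ 1 := by
  have hp := chiE_mem p
  have hq := chiE_mem q
  simp only [mem_insert_iff, mem_singleton_iff] at hp hq
  rcases hp with hp | hp <;> rcases hq with hq | hq <;> simp [hp, hq]

lemma pVar_eq : pVar chiE = 1 := by
  apply le_antisymm
  · unfold pVar
    refine iSup_le fun n => iSup_le fun γ => iSup_le fun hs => iSup_le fun hd => ?_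
    have hz : ∀ i, (∀ p ∈ (γ i).image, (p : E2) ≠ 0) →
        ENNReal.ofReal |chiE ((γ i).toFun (γ i).len) - chiE ((γ i).toFun 0)| = 0 := by
      intro i hi
      rw [curve_const (γ i) hi]; simp
    by_cases hex : ∃ i, ∃ p ∈ (γ i).image, (p : E2) = 0
    · obtain ⟨i, p, hp, hp0⟩ := hex
      rw [Finset.sum_eq_single i]
      · calc _ ≤ ENNReal.ofReal 1 := ENNReal.ofReal_le_ofReal (abs_chi_le _ _)
          _ = 1 := by simp
      · intro j _ hji
        apply hz
        intro q hq hq0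
        have : p = q := Subtype.ext (hp0.trans hq0.symm)
        subst this
        exact Set.disjoint_left.1 (hd j i hji) hq hp
      · simp
    · push Not at hex
      rw [Finset.sum_eq_zero fun i _ => hz i (hex i)]
      simp
  · have hL := rad_pos 2
    have hR : rad 2 ∈ Icc 0 (rad 2) := right_mem_Icc.2 hL.le
    have h0 : (0 : ℝ) ∈ Icc 0 (rad 2) := left_mem_Icc.2 hL.le
    have hX := ray_mem_X (j := 2) (k := 3) (by norm_num) (three_lt le_rfl)
    set γ := rcCurve (ang 2 3) (rad 2) hL.le hX (rad 2) hR
      with hγ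
    have hsimple : γ.IsSimple := by
      intro x hx y hy hxy
      have : edist (γ.toFun x) (γ.toFun y) = 0 := by rw [hxy, edist_self]
      rw [hγ] at this
      change x ∈ Icc 0 (rad 2) at hx
      change y ∈ Icc 0 (rad 2) at hy
      change edist (rc (ang 2 3) (rad 2) hL.le hX x)
        (rc (ang 2 3) (rad 2) hL.le hX y) = 0 at this
      rw [rc_edist hx hy] at this
      exact edist_eq_zero.1 this
    have e1 : chiE (γ.toFun γ.len) = 0 := by
      apply chiE_of_notMem
      change (rc (ang 2 3) (rad 2) hL.le hX (rad 2) : E2) ∉ setE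
      rw [rc_coe hR]
      exact three_notMem le_rfl hL.ne'
    have e0 : chiE (γ.toFun 0) = 1 := by
      apply chiE_of_mem
      change (rc (ang 2 3) (rad 2) hL.le hX 0 : E2) ∈ setE
      rw [rc_coe h0, zero_smul]
      exact zero_mem_E
    unfold pVar
    refine le_iSup_of_le 1 (le_iSup_of_le (fun _ => γ) (le_iSup_of_le (fun _ => hsimple)
      (le_iSup_of_le (fun i j hij => absurd (Subsingleton.elim i j) hij) ?_)))
    simp [e1, e0]

/-- measure comparison along a ray -/
lemma map_le {θ L : ℝ} {hL : 0 ≤ L} {h : ∀ t ∈ Icc 0 L, t • dir θ ∈ spaceX} :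
    (volume.restrict (Ioc 0 L)).map (rc θ L hL h) ≤
      (μH[1] : Measure spaceX).restrict (Subtype.val ⁻¹' ray (dir θ)) := by
  rw [Measure.le_iff]
  intro B hB
  rw [Measure.map_apply rc_cont.measurable hB, Measure.restrict_apply (rc_cont.measurable hB),
    Measure.restrict_apply hB, ← hausdorffMeasure_real]
  have hlip : LipschitzWith 1 (fun p : spaceX => ‖(p : E2)‖) := by
    have := (lipschitzWith_one_norm (E := E2)).comp (LipschitzWith.subtype_val spaceX)
    rw [one_mul] at this
    exact this
  have hle := hlip.hausdorffMeasure_image_le (d := 1) zero_le_one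
    (B ∩ Subtype.val ⁻¹' ray (dir θ))
  rw [ENNReal.coe_one, ENNReal.one_rpow, one_mul] at hle
  refine (measure_mono ?_).trans hle
  rintro s ⟨hsB, hs⟩
  have hs' : s ∈ Icc 0 L := Ioc_subset_Icc_self hs
  refine ⟨rc θ L hL h s, ⟨hsB, ?_⟩, ?_⟩
  · rw [mem_preimage, rc_coe hs']
    exact smul_mem_ray hs.1 θ
  · simp only [rc_coe hs', norm_smul_dir, abs_of_pos hs.1]

lemma ray_estimate {θ L : ℝ} (hL : 0 < L) (h : ∀ t ∈ Icc 0 L, t • dir θ ∈ spaceX)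
    {u : spaceX → ℝ} {g : spaceX → ℝ≥0∞} (hg : IsUpperGradient u g) {c : ℝ}
    (hchi : ∀ t ∈ Ioc 0 L, ∀ p : spaceX, (p : E2) = t • dir θ → chiE p = c) {z : spaceX}
    (hz : (z : E2) = 0)
    (hc : 1 / 2 ≤ |c - u z|)
    (hI : ∫⁻ x, ENNReal.ofReal |u x - chiE x| ∂(μH[1] : Measure spaceX) <
      ENNReal.ofReal (1 / 4) * ENNReal.ofReal L) :
    ENNReal.ofReal (1 / 4) ≤ ∫⁻ x in Subtype.val ⁻¹' ray (dir θ), g x ∂(μH[1] : Measure spaceX) := by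
  have hmeas : MeasurableSet (rc θ L hL.le h '' Ioc 0 L) := by
    have : rc θ L hL.le h '' Ioc 0 L =
        rc θ L hL.le h '' Icc 0 L ∩ Subtype.val ⁻¹' ray (dir θ) := by
      ext p
      constructor
      · rintro ⟨s, hs, rfl⟩
        have hs' := Ioc_subset_Icc_self hs
        refine ⟨⟨s, hs', rfl⟩, ?_⟩
        rw [mem_preimage, rc_coe hs']
        exact smul_mem_ray hs.1 θ
      · rintro ⟨⟨s, hs, rfl⟩, hr⟩
        refine ⟨s, ⟨lt_of_le_of_ne hs.1 ?_, hs.2⟩, rfl⟩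
        rintro rfl
        rw [mem_preimage, rc_coe hs, zero_smul] at hr
        exact hr.2 rfl
    rw [this]
    exact (isCompact_Icc.image rc_cont).isClosed.measurableSet.inter
      (measurable_subtype_coe (measurableSet_ray _))
  have hgood : ∃ t ∈ Ioc 0 L, |u (rc θ L hL.le h t) - c| < 1 / 4 := by
    by_contra hcon
    push Not at hcon
    refine absurd hI (not_lt.2 ?_)
    calc ENNReal.ofReal (1 / 4) * ENNReal.ofReal L
        ≤ ENNReal.ofReal (1 / 4) * (μH[1] : Measure spaceX) (rc θ L hL.le h '' Ioc 0 L) := by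
          gcongr
          have hlip : LipschitzWith 1 (fun p : spaceX => ‖(p : E2)‖) := by
            have := (lipschitzWith_one_norm (E := E2)).comp (LipschitzWith.subtype_val spaceX)
            rw [one_mul] at this
            exact this
          have hle := hlip.hausdorffMeasure_image_le (d := 1) zero_le_one
            (rc θ L hL.le h '' Ioc 0 L)
          rw [ENNReal.coe_one, ENNReal.one_rpow, one_mul, hausdorffMeasure_real] at hle
          refine le_trans ?_ hle
          calc ENNReal.ofReal L = volume (Ioc 0 L) := by simp
            _ ≤ _ := by
              refine measure_mono fun s hs => ?_
              refine ⟨_, ⟨s, hs, rfl⟩, ?_⟩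
              simp only [rc_coe (Ioc_subset_Icc_self hs), norm_smul_dir, abs_of_pos hs.1]
      _ = ∫⁻ _ in rc θ L hL.le h '' Ioc 0 L, ENNReal.ofReal (1 / 4)
            ∂(μH[1] : Measure spaceX) := by rw [setLIntegral_const]
      _ ≤ ∫⁻ x in rc θ L hL.le h '' Ioc 0 L, ENNReal.ofReal |u x - chiE x|
            ∂(μH[1] : Measure spaceX) := by
          refine setLIntegral_mono' hmeas ?_
          rintro _ ⟨t, ht, rfl⟩
          apply ENNReal.ofReal_le_ofReal
          rw [hchi t ht _ (rc_coe (Ioc_subset_Icc_self ht))]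
          exact hcon t ht
      _ ≤ _ := setLIntegral_le_lintegral _ _
  obtain ⟨t, ht, htu⟩ := hgood
  have ht' := Ioc_subset_Icc_self ht
  have hug := hg.2 (rcCurve θ L hL.le h t ht')
  have hzero : rc θ L hL.le h 0 = z := by
    apply Subtype.ext
    rw [rc_coe (left_mem_Icc.2 hL.le), hz, zero_smul]
  change ENNReal.ofReal |u (rc θ L hL.le h t) - u (rc θ L hL.le h 0)| ≤
    ∫⁻ s in Icc 0 t, g (rc θ L hL.le h s) at hug
  rw [hzero] at hug
  calc ENNReal.ofReal (1 / 4) ≤ ENNReal.ofReal |u (rc θ L hL.le h t) - u z| := by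
        apply ENNReal.ofReal_le_ofReal
        have h3 := abs_sub_abs_le_abs_sub (c - u z) (c - u (rc θ L hL.le h t))
        have h4 : |c - u z - (c - u (rc θ L hL.le h t))| = |u (rc θ L hL.le h t) - u z| := by
          congr 1; ring
        rw [h4, abs_sub_comm c (u (rc θ L hL.le h t))] at h3
        linarith
    _ ≤ _ := hug
    _ ≤ ∫⁻ s in Icc 0 L, g (rc θ L hL.le h s) :=
        lintegral_mono_set (Icc_subset_Icc le_rfl ht.2)
    _ = ∫⁻ s in Ioc 0 L, g (rc θ L hL.le h s) := by
        rw [restrict_Ioc_eq_restrict_Icc]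
    _ = ∫⁻ x, g x ∂((volume.restrict (Ioc 0 L)).map (rc θ L hL.le h)) := by
        rw [lintegral_map hg.1 rc_cont.measurable]
    _ ≤ _ := lintegral_mono' map_le le_rfl

lemma sum_estimate {n : ℕ} {θ : ℕ → ℝ} (hθ : Function.Injective fun i => dir (θ i))
    {g : spaceX → ℝ≥0∞}
    (h : ∀ i < n, ENNReal.ofReal (1 / 4) ≤
      ∫⁻ x in Subtype.val ⁻¹' ray (dir (θ i)), g x ∂(μH[1] : Measure spaceX)) :
    n * ENNReal.ofReal (1 / 4) ≤ ∫⁻ x, g x ∂(μH[1] : Measure spaceX) := by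
  calc n * ENNReal.ofReal (1 / 4) = ∑ i ∈ Finset.range n, ENNReal.ofReal (1 / 4) := by simp
    _ ≤ ∑ i ∈ Finset.range n, ∫⁻ x in Subtype.val ⁻¹' ray (dir (θ i)), g x
          ∂(μH[1] : Measure spaceX) :=
        Finset.sum_le_sum fun i hi => h i (Finset.mem_range.1 hi)
    _ = ∫⁻ x in ⋃ i ∈ Finset.range n, Subtype.val ⁻¹' ray (dir (θ i)), g x
          ∂(μH[1] : Measure spaceX) := by
        rw [lintegral_biUnion_finset]
        · intro i _ j _ hij
          exact (ray_disjoint (hθ.ne hij)).preimage _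
        · exact fun i _ => measurable_subtype_coe (measurableSet_ray _)
    _ ≤ _ := setLIntegral_le_lintegral _ _

lemma pow_inj {i j m : ℕ} (hm : m ≠ 0) (h : m * 2 ^ i = m * 2 ^ j) : i = j :=
  Nat.pow_right_injective le_rfl (Nat.eq_of_mul_eq_mul_left (Nat.pos_of_ne_zero hm) h)

lemma totalVar_eq : totalVarH (μH[1] : Measure spaceX) chiE = ⊤ := by
  unfold totalVarH
  simp only [iInf_eq_top]
  intro u g hg hu
  have key : ∀ n : ℕ, n * ENNReal.ofReal (1 / 4) ≤
      Filter.atTop.liminf (fun i => ∫⁻ x, g i x ∂(μH[1] : Measure spaceX)) := by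
    intro n
    apply Filter.le_liminf_of_le
    · isBoundedDefault
    have hpos : 0 < ENNReal.ofReal (1 / 4) * ENNReal.ofReal (rad (n + 2)) := by
      refine ENNReal.mul_pos ?_ ?_
      · simp
      · simpa using rad_pos (n + 2)
    filter_upwards [hu.eventually (gt_mem_nhds hpos)] with i hi
    have hI : ∀ m ≤ n + 2, ∫⁻ x, ENNReal.ofReal |u i x - chiE x| ∂(μH[1] : Measure spaceX) <
        ENNReal.ofReal (1 / 4) * ENNReal.ofReal (rad m) := by
      intro m hm
      refine lt_of_lt_of_le hi ?_
      gcongr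
      exact rad_anti.antitone hm
    let z : spaceX := ⟨0, E_sub_X zero_mem_E⟩
    rcases le_total (u i z) (1 / 2) with hc | hc
    · refine sum_estimate (θ := fun m => ang (m + 1) 1) ?_ ?_
      · intro a b hab
        have := ang_eq (dir_inj (ang_mem (Nat.one_lt_two_pow (by omega)))
          (ang_mem (Nat.one_lt_two_pow (by omega))) hab)
        have := pow_inj one_ne_zero this
        omega
      · intro m hm
        refine ray_estimate (c := 1) (rad_pos (m + 1))
          (ray_mem_X (by omega) (Nat.one_lt_two_pow (by omega))) (hg i) ?_ (z := z) rfl ?_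
          (hI _ (by omega))
        · intro t ht p hp
          apply chiE_of_mem
          rw [hp]
          exact mem_E.2 ⟨m + 1, by omega, t, ⟨by linarith [ht.1, rad_pos (m + 1)], ht.2⟩, rfl⟩
        · exact le_trans (by linarith) (le_abs_self _)
    · refine sum_estimate (θ := fun m => ang (m + 2) 3) ?_ ?_
      · intro a b hab
        have := ang_eq (dir_inj (ang_mem (three_lt (by omega)))
          (ang_mem (three_lt (by omega))) hab)
        have := pow_inj three_ne_zero this
        omega
      · intro m hm
        refine ray_estimate (c := 0) (rad_pos (m + 2))
          (ray_mem_X (by omega) (three_lt (by omega))) (hg i) ?_ (z := z) rfl ?_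
          (hI _ (by omega))
        · intro t ht p hp
          apply chiE_of_notMem
          rw [hp]
          exact three_notMem (by omega) ht.1.ne'
        · exact le_trans (by linarith) (neg_le_abs _)
  rw [eq_top_iff]
  have h14 : (ENNReal.ofReal (1 / 4)) ≠ 0 := by simp
  rw [← ENNReal.top_mul h14, ← ENNReal.iSup_natCast, ENNReal.iSup_mul]
  exact iSup_le key

lemma seg_measure (θ a : ℝ) : (μH[1] : Measure E2) (seg θ a) ≤ ENNReal.ofReal (2 * a) := by
  have hlip : LipschitzWith 1 (fun t : ℝ => t • dir θ) := by
    apply LipschitzWith.of_dist_le_mul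
    intro x y
    rw [dist_eq_norm, ← sub_smul, norm_smul_dir, Real.dist_eq]
    simp
  have hle := hlip.hausdorffMeasure_image_le (d := 1) zero_le_one (Icc (-a) a)
  rw [ENNReal.coe_one, ENNReal.one_rpow, one_mul, hausdorffMeasure_real, Real.volume_Icc] at hle
  refine hle.trans (le_of_eq ?_)
  congr 1; ring

lemma lower_bound {j : ℕ} (hj : 1 ≤ j) {r : ℝ} (hr : r ≤ rad j) :
    ENNReal.ofReal (2 ^ j * r) ≤ μH[1] (Metric.ball (0 : E2) r ∩ spaceX) := by
  have hone : ∀ k < 2 ^ j, ENNReal.ofReal r ≤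
      μH[1] (ray (dir (ang j k)) ∩ (Metric.ball (0 : E2) r ∩ spaceX)) := by
    intro k hk
    have hle := (lipschitzWith_one_norm (E := E2)).hausdorffMeasure_image_le (d := 1) zero_le_one
      (ray (dir (ang j k)) ∩ (Metric.ball (0 : E2) r ∩ spaceX))
    rw [ENNReal.coe_one, ENNReal.one_rpow, one_mul, hausdorffMeasure_real] at hle
    refine le_trans ?_ hle
    calc ENNReal.ofReal r = volume (Ioo 0 r) := by simp
      _ ≤ _ := by
        refine measure_mono fun s hs => ?_
        refine ⟨s • dir (ang j k), ⟨smul_mem_ray hs.1 _, ?_, ?_⟩, ?_⟩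
        · rw [mem_ball_zero_iff, norm_smul_dir, abs_of_pos hs.1]
          exact hs.2
        · exact ray_mem_X hj hk s ⟨hs.1.le, hs.2.le.trans hr⟩
        · rw [norm_smul_dir, abs_of_pos hs.1]
  calc ENNReal.ofReal (2 ^ j * r) = ∑ k ∈ Finset.range (2 ^ j), ENNReal.ofReal r := by
        rw [ENNReal.ofReal_mul (by positivity), ENNReal.ofReal_pow (by norm_num)]
        simp
    _ ≤ ∑ k ∈ Finset.range (2 ^ j), (μH[1] : Measure E2).restrict
          (Metric.ball (0 : E2) r ∩ spaceX) (ray (dir (ang j k))) := by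
        refine Finset.sum_le_sum fun k hk => ?_
        rw [Measure.restrict_apply (measurableSet_ray _)]
        exact hone k (Finset.mem_range.1 hk)
    _ = (μH[1] : Measure E2).restrict (Metric.ball (0 : E2) r ∩ spaceX)
          (⋃ k ∈ Finset.range (2 ^ j), ray (dir (ang j k))) := by
        rw [measure_biUnion_finset]
        · intro k hk l hl hkl
          apply ray_disjoint
          intro hd
          apply hkl
          have := ang_eq (dir_inj (ang_mem (Finset.mem_range.1 hk))
            (ang_mem (Finset.mem_range.1 hl)) hd)
          exact Nat.eq_of_mul_eq_mul_right (by positivity) this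
        · exact fun k _ => measurableSet_ray _
    _ ≤ (μH[1] : Measure E2).restrict (Metric.ball (0 : E2) r ∩ spaceX) univ :=
        measure_mono (subset_univ _)
    _ = _ := by rw [Measure.restrict_apply_univ]

lemma upper_bound {j : ℕ} {r : ℝ} (hr0 : 0 < r) (hr : rad (j + 1) ≤ r) :
    μH[1] (Metric.ball (0 : E2) r ∩ setE) ≤ ENNReal.ofReal ((2 * j + 6) * r) := by
  have hsub : Metric.ball (0 : E2) r ∩ setE ⊆
      (⋃ i ∈ Finset.range (j + 1), seg (ang i 1) r) ∪
        ⋃ m : ℕ, seg (ang (j + 1 + m) 1) (rad (j + 1 + m)) := by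
    rintro p ⟨hp, hpE⟩
    obtain ⟨i, hi, hpi⟩ := mem_E.1 hpE
    rcases lt_or_ge i (j + 1) with h | h
    · left
      simp only [mem_iUnion, exists_prop, Finset.mem_range]
      refine ⟨i, h, ?_⟩
      obtain ⟨t, ht, rfl⟩ := hpi
      rw [mem_ball_zero_iff, norm_smul_dir] at hp
      exact ⟨t, abs_le.1 hp.le, rfl⟩
    · right
      obtain ⟨m, rfl⟩ := Nat.exists_eq_add_of_le h
      exact mem_iUnion.2 ⟨m, hpi⟩
  have hrad : ∀ m, rad (j + 1 + m) ≤ r * (1 / 2) ^ m := by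
    intro m
    induction m with
    | zero => simpa using hr
    | succ m ih =>
      have h1 := rad_pos (j + 1 + m)
      rw [← add_assoc, rad_succ, pow_succ]
      linarith
  calc _ ≤ _ := measure_mono hsub
    _ ≤ _ := measure_union_le _ _
    _ ≤ (∑ i ∈ Finset.range (j + 1), ENNReal.ofReal (2 * r)) +
        ∑' m : ℕ, ENNReal.ofReal (2 * r * (1 / 2) ^ m) := by
      gcongr
      · refine (measure_biUnion_finset_le _ _).trans ?_
        exact Finset.sum_le_sum fun i _ => seg_measure _ _
      · refine (measure_iUnion_le _).trans ?_
        refine ENNReal.tsum_le_tsum fun m => (seg_measure _ _).trans ?_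
        apply ENNReal.ofReal_le_ofReal
        linarith [hrad m]
    _ = ENNReal.ofReal ((j + 1 : ℕ) * (2 * r)) + ENNReal.ofReal (2 * r * 2) := by
      congr 1
      · rw [ENNReal.ofReal_mul (p := ((j + 1 : ℕ) : ℝ)) (by positivity), ENNReal.ofReal_natCast,
          Finset.sum_const, Finset.card_range, nsmul_eq_mul]
      · rw [← ENNReal.ofReal_tsum_of_nonneg (fun m => by positivity)
          (summable_geometric_two.mul_left _), tsum_mul_left, tsum_geometric_two]
    _ = _ := by
      rw [← ENNReal.ofReal_add (by positivity) (by positivity)]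
      congr 1; push_cast; ring

lemma tendsto_aux : Tendsto (fun j : ℕ => ((2 * j + 6) / 2 ^ j : ℝ)) atTop (𝓝 0) := by
  have h1 := tendsto_self_mul_const_pow_of_lt_one (r := (1 / 2 : ℝ)) (by norm_num) (by norm_num)
  have h2 := tendsto_pow_atTop_nhds_zero_of_lt_one (r := (1 / 2 : ℝ)) (by norm_num) (by norm_num)
  have := (h1.const_mul 2).add (h2.const_mul 6)
  simp only [mul_zero, add_zero] at this
  refine this.congr fun j => ?_
  rw [one_div, inv_pow]
  ring

lemma limsup_zero : Filter.limsup
        (fun r : ℝ => μH[1] (Metric.ball (0 : E2) r ∩ setE)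
          / μH[1] (Metric.ball (0 : E2) r ∩ spaceX)) (𝓝[>] 0) = 0 := by
  apply Tendsto.limsup_eq
  rw [ENNReal.tendsto_nhds_zero]
  intro ε hε
  have ht : Tendsto (fun j : ℕ => ENNReal.ofReal ((2 * j + 6) / 2 ^ j : ℝ)) atTop (𝓝 0) := by
    simpa using ENNReal.tendsto_ofReal tendsto_aux
  obtain ⟨J, hJ⟩ := eventually_atTop.1 ((ENNReal.tendsto_nhds_zero.1 ht) ε hε)
  have hmem : Ioo 0 (rad (J + 1)) ∈ 𝓝[>] (0 : ℝ) := Ioo_mem_nhdsGT (rad_pos _)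
  filter_upwards [hmem] with r hr
  have hex : ∃ m, rad m < r := (rad_tendsto.eventually (gt_mem_nhds hr.1)).exists
  classical
  obtain ⟨j, hj, h1, h2⟩ : ∃ j, J + 1 ≤ j ∧ rad (j + 1) ≤ r ∧ r ≤ rad j := by
    have hs := Nat.find_spec hex
    have hm : J + 1 < Nat.find hex := rad_anti.lt_iff_gt.1 (hs.trans hr.2)
    obtain ⟨j, hj⟩ := Nat.exists_eq_add_of_lt (Nat.zero_lt_of_lt hm)
    rw [zero_add] at hj
    rw [hj] at hs
    refine ⟨j, by omega, hs.le, ?_⟩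
    exact not_lt.1 (Nat.find_min hex (by omega : j < Nat.find hex))
  have hpos : 0 < (2 : ℝ) ^ j * r := mul_pos (by positivity) hr.1
  calc _ ≤ ENNReal.ofReal ((2 * j + 6) * r) / ENNReal.ofReal (2 ^ j * r) :=
        ENNReal.div_le_div (upper_bound hr.1 h1) (lower_bound (by omega) h2)
    _ = ENNReal.ofReal ((2 * j + 6) / 2 ^ j) := by
        rw [← ENNReal.ofReal_div_of_pos hpos, mul_div_mul_right _ _ hr.1.ne']
    _ ≤ ε := hJ j (by omega)

lemma boundary_empty : mtBoundary = ∅ := by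
  rw [eq_empty_iff_forall_notMem]
  rintro x ⟨h1, h2⟩
  by_cases hx : (x : E2) = 0
  · rw [hx, limsup_zero] at h1
    exact lt_irrefl _ h1
  · obtain ⟨δ, hδ, h⟩ := local_const hx
    have hmem : Ioo 0 δ ∈ 𝓝[>] (0 : ℝ) := Ioo_mem_nhdsGT hδ
    rcases h with h | h
    · refine h2.ne' (Tendsto.limsup_eq (tendsto_const_nhds.congr' ?_))
      filter_upwards [hmem] with r hr
      have : (Metric.ball (x : E2) r ∩ spaceX) \ setE = ∅ :=
        sdiff_eq_empty.2 ((inter_subset_inter_left _ (Metric.ball_subset_ball hr.2.le)).trans h)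
      rw [this]; simp
    · refine h1.ne' (Tendsto.limsup_eq (tendsto_const_nhds.congr' ?_))
      filter_upwards [hmem] with r hr
      have : Metric.ball (x : E2) r ∩ setE = ∅ :=
        subset_empty_iff.1 ((inter_subset_inter_left _ (Metric.ball_subset_ball hr.2.le)).trans h.le)
      rw [this]; simp

end Fed

/-- The measure-theoretic boundary of `E` is empty, `pV(χ_E, X) = 1`, and yet `E` is not
of finite perimeter: `‖Dχ_E‖(X) = ∞`. Hence the "if" direction of Federer's
characterization fails for this doubling space without a Poincaré inequality. -/
theorem stmt19 :
    mtBoundary = ∅ ∧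
    pVar chiE = 1 ∧
    totalVarH (μH[1] : Measure spaceX) chiE = ⊤ :=
  ⟨Fed.boundary_empty, Fed.pVar_eq, Fed.totalVar_eq⟩
end
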